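/- arXiv:2204.01481 — 2 statements merged into one kernel-verified Lean document; each statement's English description precedes it below -/
import Mathlib

section
/- For every complex number x ≠ 0, at least one of x and e^{ix} is transcendental over ℚ. -/
open Polynomial Filter
open scoped Nat

namespace HermiteLindemann

/-- Finitely many nonzero algebraic numbers are common roots of an integer polynomial
that does not vanish at zero. -/
theorem exists_int_polynomial_eval_zero_ne_zero {K : Type*} [Field K] [CharZero K]
    [Algebra.IsAlgebraic ℤ K] (S : Finset K) (hS : ∀ s ∈ S, s ≠ 0) :
    ∃ f : ℤ[X], f.eval 0 ≠ 0 ∧ ∀ s ∈ S, aeval s f = 0 := by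
  have h (s : K) : ∃ f : ℤ[X], s ≠ 0 → f.eval 0 ≠ 0 ∧ aeval s f = 0 := by
    by_cases hs : s = 0
    · exact ⟨0, fun h ↦ absurd hs h⟩
    · obtain ⟨f, hf, hf0⟩ := (Algebra.IsAlgebraic.isAlgebraic (R := ℤ) s)
        |>.exists_nonzero_coeff_and_aeval_eq_zero (mem_nonZeroDivisors_of_ne_zero hs)
      exact ⟨f, fun _ ↦ ⟨by rwa [← coeff_zero_eq_eval_zero], hf0⟩⟩
  choose f hf using h
  refine ⟨∏ s ∈ S, f s, ?_, fun s hs ↦ ?_⟩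
  · rw [eval_prod]
    exact Finset.prod_ne_zero_iff.mpr fun s hs ↦ (hf s (hS s hs)).1
  · rw [map_prod]
    exact Finset.prod_eq_zero hs (hf s (hS s hs)).2

theorem isIntegral_pow_smul_aeval {K : Type*} [Field K] {L : ℤ} {s : K}
    (hs : IsIntegral ℤ (L • s)) {g : ℤ[X]} {N : ℕ} (hg : g.natDegree ≤ N) :
    IsIntegral ℤ (L ^ N • aeval s g) := by
  rw [aeval_eq_sum_range' (Nat.lt_succ_of_le hg), Finset.smul_sum]
  refine IsIntegral.sum _ fun i hi ↦ ?_
  have hi : i ≤ N := Nat.lt_succ_iff.mp (Finset.mem_range.mp hi)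
  have : L ^ N • g.coeff i • s ^ i = (L ^ (N - i) * g.coeff i) • (L • s) ^ i := by
    rw [_root_.smul_pow, smul_smul, smul_smul, ← Nat.sub_add_cancel hi, pow_add]
    congr 1
    simp only [Nat.add_sub_cancel]
    ring
  rw [this]
  exact (hs.pow i).smul _

theorem exists_int_eq_of_isIntegral_of_fixed {K : Type*} [Field K] [NumberField K] [IsGalois ℚ K]
    {x : K} (hx : IsIntegral ℤ x) (hfix : ∀ σ : Gal(K/ℚ), σ x = x) : ∃ m : ℤ, (m : K) = x := by
  obtain ⟨q, rfl⟩ := (IsGalois.mem_range_algebraMap_iff_fixed x).mpr hfix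
  rw [isIntegral_algebraMap_iff (algebraMap ℚ K).injective] at hx
  obtain ⟨m, rfl⟩ := IsIntegrallyClosed.isIntegral_iff.mp hx
  exact ⟨m, by simp⟩

theorem exists_prime_gt_mul_pow_div_factorial_lt_one (B : ℕ) (C A : ℝ) :
    ∃ p > B, p.Prime ∧ C * (A ^ p / (p - 1)!) < 1 := by
  have h : Tendsto (fun k : ℕ ↦ C * A * (A ^ k / k !)) atTop (nhds (C * A * 0)) :=
    (FloorSemiring.tendsto_pow_div_factorial_atTop A).const_mul _
  rw [mul_zero] at h
  obtain ⟨k, hk⟩ := eventually_atTop.mp (h.eventually (gt_mem_nhds one_pos))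
  obtain ⟨p, hp, hprime⟩ := Nat.exists_infinite_primes (k + B + 1)
  refine ⟨p, by omega, hprime, ?_⟩
  obtain ⟨q, rfl⟩ : ∃ q, p = q + 1 := ⟨p - 1, by omega⟩
  have h1 := hk q (by omega)
  rwa [mul_assoc, ← mul_div_assoc, ← pow_succ'] at h1

/-- A Galois-invariant integral linear relation between exponentials of elements of a number field
has vanishing constant coefficient. -/
theorem coeff_zero_eq_zero_of_sum_exp_eq_zero {K : Type*} [Field K] [NumberField K] [IsGalois ℚ K]
    (ι : K →+* ℂ) (G : K →₀ ℤ) (hG : ∀ (σ : Gal(K/ℚ)) (s : K), G (σ s) = G s)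
    (hsum : (G.sum fun s c ↦ c • Complex.exp (ι s)) = 0) : G 0 = 0 := by
  classical
  by_contra hw
  have : Algebra.IsAlgebraic ℤ K :=
    (IsFractionRing.comap_isAlgebraic_iff (A := ℤ) (K := ℚ) (C := K)).mpr inferInstance
  set S := G.support.erase 0 with hS
  obtain ⟨f, hf0, hf⟩ := exists_int_polynomial_eval_zero_ne_zero S
    fun s hs ↦ Finset.ne_of_mem_erase hs
  obtain ⟨L, hL0, hL⟩ := Algebra.IsAlgebraic.exists_integral_multiples ℤ S
  obtain ⟨c, hc⟩ := LindemannWeierstrass.exp_polynomial_approx f hf0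
  have hrel : (G 0 : ℂ) + ∑ s ∈ S, (G s : ℂ) * Complex.exp (ι s) = 0 := by
    rw [Finsupp.sum, ← Finset.add_sum_erase _ _ (Finsupp.mem_support_iff.mpr hw)] at hsum
    simpa using hsum
  obtain ⟨p, hpB, hp, hlt⟩ := exists_prime_gt_mul_pow_div_factorial_lt_one
    ((f.eval 0).natAbs + L.natAbs + (G 0).natAbs) (∑ s ∈ S, |(G s : ℝ)|)
    (|(L : ℝ)| ^ f.natDegree * |c|)
  obtain ⟨n, hn, g, hg, happrox⟩ := hc p (by omega) hp
  have hgdeg : g.natDegree ≤ p * f.natDegree := hg.trans (Nat.sub_le _ _)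
  obtain ⟨m, hm⟩ : ∃ m : ℤ, (m : K) = ∑ s ∈ S, G s • L ^ (p * f.natDegree) • aeval s g := by
    refine exists_int_eq_of_isIntegral_of_fixed
      (IsIntegral.sum _ fun s hs ↦ (isIntegral_pow_smul_aeval (hL s hs) hgdeg).smul _) fun σ ↦ ?_
    rw [map_sum]
    refine Finset.sum_equiv σ.toEquiv (fun s ↦ ?_) fun s _ ↦ ?_
    · simp [S, hG]
    · have : σ (aeval s g) = aeval (σ s) g :=
        (aeval_algHom_apply (σ : K →+* K).toIntAlgHom s g).symm
      simp [hG, this]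
  have hmι : (m : ℂ) = ∑ s ∈ S, (G s : ℂ) * (L ^ (p * f.natDegree) * aeval (ι s) g) := by
    have hι (s : K) : ι (aeval s g) = aeval (ι s) g := (aeval_algHom_apply ι.toIntAlgHom s g).symm
    simpa [hι] using congrArg ι hm
  set M : ℤ := L ^ (p * f.natDegree) * n * G 0 + p * m with hM
  have hMeq : (M : ℂ) = -∑ s ∈ S, (G s : ℂ) *
      (L ^ (p * f.natDegree) * (n • Complex.exp (ι s) - p • aeval (ι s) g)) := by
    have hG0 : (G 0 : ℂ) = -∑ s ∈ S, (G s : ℂ) * Complex.exp (ι s) :=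
      eq_neg_of_add_eq_zero_left hrel
    rw [hM]
    push_cast
    rw [hG0, hmι, mul_neg, Finset.mul_sum, Finset.mul_sum, neg_add_eq_sub,
      ← Finset.sum_sub_distrib, ← Finset.sum_neg_distrib]
    refine Finset.sum_congr rfl fun s _ ↦ ?_
    simp only [zsmul_eq_mul, nsmul_eq_mul]
    ring
  have hMlt : |(M : ℝ)| < 1 := by
    refine lt_of_le_of_lt ?_ hlt
    rw [← Complex.norm_intCast, hMeq, norm_neg, Finset.sum_mul]
    refine (norm_sum_le _ _).trans (Finset.sum_le_sum fun s hs ↦ ?_)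
    have hroot : ι s ∈ f.aroots ℂ := by
      rw [mem_aroots]
      refine ⟨fun h ↦ hf0 (by simp [h]), ?_⟩
      rw [show aeval (ι s) f = ι (aeval s f) from aeval_algHom_apply ι.toIntAlgHom s f, hf s hs,
        map_zero]
    rw [norm_mul, norm_mul, Complex.norm_intCast, norm_pow, Complex.norm_intCast, mul_pow,
      ← pow_mul, mul_comm f.natDegree p, mul_div_assoc]
    gcongr
    refine (happrox hroot).trans ?_
    gcongr ?_ / _
    rw [← abs_pow]
    exact le_abs_self _
  have hM0 : M = 0 := Int.abs_lt_one_iff.mp (by exact_mod_cast hMlt)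
  have hdvd : (p : ℤ) ∣ L ^ (p * f.natDegree) * n * G 0 :=
    (Int.dvd_add_left (dvd_mul_right _ m)).mp (by rw [← hM, hM0]; exact dvd_zero _)
  have hprime := Nat.prime_iff_prime_int.mp hp
  have hndvd {k : ℤ} (hk : k ≠ 0) (hkp : k.natAbs < p) : ¬ (p : ℤ) ∣ k := fun h ↦
    absurd (Nat.le_of_dvd (Int.natAbs_pos.mpr hk) (Int.natCast_dvd.mp h)) (by omega)
  rcases hprime.dvd_or_dvd hdvd with h | h
  · rcases hprime.dvd_or_dvd h with h | h
    · exact hndvd hL0 (by omega) (hprime.dvd_of_dvd_pow h)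
    · exact hn h
  · exact hndvd hw (by omega) h

theorem aeval_single_one_ne_zero {K : Type*} [Field K] [CharZero K] {b : K} (hb : b ≠ 0)
    {P : ℤ[X]} (hP : P ≠ 0) : aeval (AddMonoidAlgebra.single b (1 : ℤ)) P ≠ 0 := by
  classical
  have hcoeff (Q : ℤ[X]) (n : ℕ) :
      (aeval (AddMonoidAlgebra.single b (1 : ℤ)) Q).coeff (n • b) = Q.coeff n := by
    induction Q using Polynomial.induction_on' with
    | add p q hp hq => 
      rw [map_add, AddMonoidAlgebra.coeff_add, Finsupp.add_apply, hp, hq, coeff_add]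
    | monomial k c =>
      rw [aeval_monomial, AddMonoidAlgebra.single_pow, ← Algebra.smul_def, one_pow,
        AddMonoidAlgebra.smul_single, AddMonoidAlgebra.coeff_single, Finsupp.single_apply,
        coeff_monomial, smul_eq_mul, mul_one]
      simp [hb]
  intro h
  refine hP (Polynomial.ext fun n ↦ ?_)
  rw [← hcoeff, h]
  simp

/-- The Hermite-Lindemann theorem over a Galois number field. -/
theorem aeval_exp_ne_zero {K : Type*} [Field K] [NumberField K] [IsGalois ℚ K] (ι : K →+* ℂ)
    {a : K} (ha : a ≠ 0) {P : ℤ[X]} (hP : P ≠ 0) : aeval (Complex.exp (ι a)) P ≠ 0 := by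
  intro hroot
  let E : AddMonoidAlgebra ℤ K →ₐ[ℤ] ℂ := AddMonoidAlgebra.lift ℤ ℂ K
    (Complex.expMonoidHom.comp ι.toAddMonoidHom.toMultiplicative)
  have hE (b : K) : E (.single b 1) = Complex.exp (ι b) := by
    simp [E]
  let act (τ : Gal(K/ℚ)) : AddMonoidAlgebra ℤ K →ₐ[ℤ] AddMonoidAlgebra ℤ K :=
    AddMonoidAlgebra.mapDomainAlgHom ℤ ℤ (τ : K →+ K)
  have hact (τ : Gal(K/ℚ)) (b : K) : act τ (.single b 1) = .single (τ b) 1 := by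
    simp [act]
  let F : AddMonoidAlgebra ℤ K := ∏ σ : Gal(K/ℚ), aeval (AddMonoidAlgebra.single (σ a) (1 : ℤ)) P
  have hF0 : F ≠ 0 := Finset.prod_ne_zero_iff.mpr fun σ _ ↦
    aeval_single_one_ne_zero (by simpa using ha) hP
  have hEF : E F = 0 := by
    rw [map_prod]
    refine Finset.prod_eq_zero (Finset.mem_univ 1) ?_
    rw [← aeval_algHom_apply, hE]
    exact hroot
  have hactF (τ : Gal(K/ℚ)) : act τ F = F := by
    rw [map_prod]
    refine Fintype.prod_equiv (Equiv.mulLeft τ) _ _ fun σ ↦ ?_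
    rw [← aeval_algHom_apply, hact]
    rfl
  have hcoeff {H : AddMonoidAlgebra ℤ K} (hH : ∀ τ, act τ H = H) (τ : Gal(K/ℚ)) (s : K) :
      H.coeff (τ s) = H.coeff s := by
    conv_lhs => rw [← hH τ]
    exact Finsupp.mapDomain_apply τ.injective _ _
  obtain ⟨s, hs⟩ : ∃ s, F.coeff s ≠ 0 := by
    by_contra! h
    exact hF0 (AddMonoidAlgebra.ext (Finsupp.ext h))
  let R : AddMonoidAlgebra ℤ K := ∑ σ : Gal(K/ℚ), .single (σ (-s)) 1
  have hactR (τ : Gal(K/ℚ)) : act τ R = R := by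
    rw [map_sum]
    exact Fintype.sum_equiv (Equiv.mulLeft τ) _ _ fun σ ↦ hact _ _
  have hFR := coeff_zero_eq_zero_of_sum_exp_eq_zero ι (F * R).coeff
    (hcoeff fun τ ↦ by rw [map_mul, hactF, hactR]) (by
      have : E (F * R) = 0 := by rw [map_mul, hEF, zero_mul]
      rwa [AddMonoidAlgebra.lift_apply] at this)
  rw [Finset.mul_sum, AddMonoidAlgebra.coeff_sum, Finsupp.finsetSum_apply] at hFR
  simp [AddMonoidAlgebra.coeff_mul_single_apply, hcoeff hactF, hs] at hFR

/-- The Hermite-Lindemann theorem. -/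
theorem transcendental_exp {a : ℂ} (ha0 : a ≠ 0) (ha : IsAlgebraic ℚ a) :
    Transcendental ℚ (Complex.exp a) := by
  let K := IntermediateField.normalClosure ℚ (IntermediateField.adjoin ℚ {a}) ℂ
  have : FiniteDimensional ℚ (IntermediateField.adjoin ℚ {a}) :=
    IntermediateField.adjoin.finiteDimensional ha.isIntegral
  have : NumberField K := {}
  have : Normal ℚ K := (Algebra.IsAlgebraic.isNormalClosure_normalClosure
    fun _ ↦ IsAlgClosed.splits _).normal
  have : IsGalois ℚ K := ⟨⟩
  have haK : a ∈ K :=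
    IntermediateField.le_normalClosure _ (IntermediateField.mem_adjoin_simple_self ℚ a)
  intro h
  obtain ⟨P, hP, hroot⟩ := (IsFractionRing.isAlgebraic_iff ℤ ℚ ℂ).mpr h
  exact aeval_exp_ne_zero (algebraMap K ℂ) (a := ⟨a, haK⟩)
    (by simpa [Subtype.ext_iff] using ha0) hP hroot

end HermiteLindemann

theorem stmt_0 :
    ∀ x : ℂ, x ≠ 0 →
      Transcendental ℚ x ∨ Transcendental ℚ (Complex.exp (Complex.I * x)) := by
  intro x hx
  refine or_iff_not_imp_left.mpr fun h ↦ ?_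
  have hI : IsAlgebraic ℚ Complex.I := (Complex.isIntegral_rat_I).isAlgebraic
  exact HermiteLindemann.transcendental_exp (mul_ne_zero Complex.I_ne_zero hx)
    (hI.mul (not_not.mp h))
end

section
/- If f₁(x,y) and f₂(x,y) are coprime polynomials in two variables with algebraic (complex) coefficients, then the functions F₁(x) = f₁(x, e^{ix}) and F₂(x) = f₂(x, e^{ix}) have no common complex root other than possibly x = 0. -/
/-- The field of algebraic numbers: the integral closure of `ℚ` in `ℂ`. -/
noncomputable abbrev AlgNum : Subalgebra ℚ ℂ := integralClosure ℚ ℂ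

/-- Evaluate a bivariate polynomial with algebraic coefficients at `(x, e^{ix})`. -/
noncomputable def evalExp (f : MvPolynomial (Fin 2) AlgNum) (x : ℂ) : ℂ :=
  MvPolynomial.eval ![x, Complex.exp (Complex.I * x)]
    (MvPolynomial.map (algebraMap AlgNum ℂ) f)

open Polynomial

theorem Finset.exists_int_polynomial_aeval_eq_zero {K : Type*} [Field K] [CharZero K]
    [Algebra.IsAlgebraic ℚ K] (S : Finset K) (hS : (0 : K) ∉ S) :
    ∃ f : ℤ[X], f.eval 0 ≠ 0 ∧ ∀ γ ∈ S, aeval γ f = 0 := by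
  have h (γ : K) (hγ : γ ≠ 0) : ∃ f : ℤ[X], f.eval 0 ≠ 0 ∧ aeval γ f = 0 := by
    have : IsAlgebraic ℤ γ :=
      (IsFractionRing.isAlgebraic_iff ℤ ℚ K).2 (Algebra.IsAlgebraic.isAlgebraic γ)
    obtain ⟨f, hf0, hf⟩ := this.exists_nonzero_coeff_and_aeval_eq_zero
      (mem_nonZeroDivisors_of_ne_zero hγ)
    exact ⟨f, by rwa [← coeff_zero_eq_eval_zero], hf⟩
  choose! F hF0 hF using h
  have hne (γ : K) (hγ : γ ∈ S) : γ ≠ 0 := fun h ↦ hS (h ▸ hγ)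
  refine ⟨∏ γ ∈ S, F γ, ?_, fun γ hγ ↦ ?_⟩
  · rw [eval_prod]
    exact Finset.prod_ne_zero_iff.2 fun γ hγ ↦ hF0 γ (hne γ hγ)
  · rw [map_prod]
    exact Finset.prod_eq_zero hγ (hF γ (hne γ hγ))

theorem IsIntegral.pow_mul_aeval {K : Type*} [Field K] {a : ℤ} {γ : K}
    (h : IsIntegral ℤ ((a : K) * γ)) {g : ℤ[X]} {N : ℕ} (hg : g.natDegree ≤ N) :
    IsIntegral ℤ ((a : K) ^ N * aeval γ g) := by
  rw [aeval_eq_sum_range, Finset.mul_sum]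
  refine IsIntegral.sum _ fun i hi ↦ ?_
  have hi : i ≤ N := (Finset.mem_range_succ_iff.1 hi).trans hg
  have : (a : K) ^ N * g.coeff i • γ ^ i =
      algebraMap ℤ K (g.coeff i * a ^ (N - i)) * ((a : K) * γ) ^ i := by
    rw [← Nat.sub_add_cancel hi, pow_add]
    simp
    ring
  rw [this]
  exact isIntegral_algebraMap.mul (h.pow i)

theorem exists_int_eq_of_galois_fixed {K : Type*} [Field K] [NumberField K] [IsGalois ℚ K] {x : K}
    (hx : IsIntegral ℤ x) (hfix : ∀ σ : K ≃ₐ[ℚ] K, σ x = x) : ∃ m : ℤ, x = m := by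
  obtain ⟨q, rfl⟩ := (IsGalois.mem_range_algebraMap_iff_fixed x).2 hfix
  obtain ⟨m, rfl⟩ := IsIntegrallyClosed.isIntegral_iff.1
    ((isIntegral_algebraMap_iff (algebraMap ℚ K).injective).1 hx)
  exact ⟨m, by simp⟩

theorem exists_int_ne_zero_isIntegral_mul {K : Type*} [Field K] [CharZero K]
    [Algebra.IsAlgebraic ℚ K] (S : Finset K) :
    ∃ a : ℤ, a ≠ 0 ∧ ∀ γ ∈ S, IsIntegral ℤ ((a : K) * γ) := by
  have : Algebra.IsAlgebraic ℤ K := (IsFractionRing.comap_isAlgebraic_iff (K := ℚ)).2 inferInstance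
  obtain ⟨a, ha, h⟩ := Algebra.IsAlgebraic.exists_integral_multiples ℤ S
  exact ⟨a, ha, fun γ hγ ↦ by simpa using h γ hγ⟩

theorem LindemannWeierstrass.sum_exp_ne_zero_of_galois_invariant {K : Type*} [Field K]
    [NumberField K] [IsGalois ℚ K] [Algebra K ℂ] (c : K →₀ ℤ) (hc : c 0 ≠ 0)
    (hinv : ∀ (σ : K ≃ₐ[ℚ] K) (γ : K), c (σ γ) = c γ) :
    c.sum (fun γ n ↦ (n : ℂ) * Complex.exp (algebraMap K ℂ γ)) ≠ 0 := by
  classical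
  intro hsum
  set S : Finset K := c.support.erase 0 with hS
  have hsum' : (c 0 : ℂ) + ∑ γ ∈ S, (c γ : ℂ) * Complex.exp (algebraMap K ℂ γ) = 0 := by
    rw [← hsum, Finsupp.sum, ← Finset.add_sum_erase _ _ (Finsupp.mem_support_iff.2 hc)]
    simp [hS]
  obtain ⟨f, hf0, hf⟩ := S.exists_int_polynomial_aeval_eq_zero (by simp [hS])
  obtain ⟨a, ha, haS⟩ := exists_int_ne_zero_isIntegral_mul S
  obtain ⟨C, hC⟩ := exp_polynomial_approx f hf0
  set M : ℝ := ∑ γ ∈ S, ‖(c γ : ℂ)‖ with hM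
  set B : ℝ := ‖(a : ℂ)‖ ^ f.natDegree * C with hB
  have hlim : Filter.Tendsto (fun n : ℕ ↦ M * B * (B ^ n / (n.factorial : ℝ))) Filter.atTop
      (nhds 0) := by
    simpa using (FloorSemiring.tendsto_pow_div_factorial_atTop B).const_mul (M * B)
  obtain ⟨n₀, hn₀⟩ := Filter.eventually_atTop.1 (hlim.eventually (gt_mem_nhds one_pos))
  obtain ⟨p, hp, hprime⟩ := Nat.exists_infinite_primes
    (n₀ + (eval 0 f).natAbs + a.natAbs + (c 0).natAbs + 1)
  obtain ⟨n, hpn, g, hgdeg, hg⟩ := hC p (by omega) hprime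
  have hpZ : Prime (p : ℤ) := Nat.prime_iff_prime_int.1 hprime
  have not_dvd (z : ℤ) (hz : z ≠ 0) (hzp : z.natAbs < p) : ¬ (p : ℤ) ∣ z := fun h ↦
    hzp.not_ge (Nat.le_of_dvd (Int.natAbs_pos.2 hz) (Int.natCast_dvd.1 h))
  set T : K := ∑ γ ∈ S, (c γ : K) * aeval γ g with hT
  obtain ⟨m, hm⟩ : ∃ m : ℤ, (a : K) ^ (p * f.natDegree) * T = m := by
    refine exists_int_eq_of_galois_fixed ?_ fun σ ↦ ?_
    · rw [hT, Finset.mul_sum]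
      refine IsIntegral.sum _ fun γ hγ ↦ ?_
      rw [mul_left_comm]
      exact isIntegral_algebraMap.mul
        ((haS γ hγ).pow_mul_aeval (hgdeg.trans (Nat.sub_le _ _)))
    · rw [hT]
      simp only [map_mul, map_pow, map_intCast, map_sum]
      congr 1
      refine Finset.sum_bij (fun γ _ ↦ σ γ) (fun γ hγ ↦ ?_) (fun _ _ _ _ h ↦ σ.injective h)
        (fun γ hγ ↦ ⟨σ.symm γ, ?_, by simp⟩) (fun γ _ ↦ ?_)
      · simpa [hS, hinv] using hγ
      · have := hinv σ (σ.symm γ)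
        rw [σ.apply_symm_apply] at this
        simpa [hS, ← this] using hγ
      · rw [hinv]
        congr 1
        exact (aeval_algHom_apply (σ.toAlgHom.restrictScalars ℤ) γ g).symm
  have hmC :
      (a : ℂ) ^ (p * f.natDegree) * ∑ γ ∈ S, (c γ : ℂ) * aeval (algebraMap K ℂ γ) g = m := by
    have := congrArg (algebraMap K ℂ) hm
    simpa [hT, aeval_algebraMap_apply] using this
  set Z : ℤ := a ^ (p * f.natDegree) * (n * c 0) + p * m with hZ
  have hZC : (Z : ℂ) = -((a : ℂ) ^ (p * f.natDegree) * ∑ γ ∈ S, (c γ : ℂ) *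
      (n • Complex.exp (algebraMap K ℂ γ) - p • aeval (algebraMap K ℂ γ) g)) := by
    have h1 : ∑ γ ∈ S, (c γ : ℂ) *
        (n • Complex.exp (algebraMap K ℂ γ) - p • aeval (algebraMap K ℂ γ) g) =
        n * ∑ γ ∈ S, (c γ : ℂ) * Complex.exp (algebraMap K ℂ γ) -
        p * ∑ γ ∈ S, (c γ : ℂ) * aeval (algebraMap K ℂ γ) g := by
      rw [Finset.mul_sum, Finset.mul_sum, ← Finset.sum_sub_distrib]
      refine Finset.sum_congr rfl fun γ _ ↦ ?_
      simp only [zsmul_eq_mul, nsmul_eq_mul]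
      ring
    rw [h1, eq_neg_of_add_eq_zero_right hsum', hZ]
    push_cast
    rw [← hmC]
    ring
  have hZle : ‖(Z : ℂ)‖ ≤ ‖(a : ℂ)‖ ^ (p * f.natDegree) * (M * (C ^ p / (p - 1).factorial)) := by
    rw [hZC, norm_neg, norm_mul, norm_pow]
    refine mul_le_mul_of_nonneg_left ?_ (by positivity)
    rw [hM, Finset.sum_mul]
    refine norm_sum_le_of_le _ fun γ hγ ↦ ?_
    rw [norm_mul]
    refine mul_le_mul_of_nonneg_left (hg ?_) (norm_nonneg _)
    have hfne : f ≠ 0 := by rintro rfl; simp at hf0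
    rw [mem_aroots]
    exact ⟨hfne, by rw [aeval_algebraMap_apply, hf γ hγ, map_zero]⟩
  have hZlt : ‖(Z : ℂ)‖ < 1 := by
    refine hZle.trans_lt (lt_of_eq_of_lt ?_ (hn₀ (p - 1) (by omega)))
    have hpp : B ^ p = B * B ^ (p - 1) := by
      rw [← pow_succ', Nat.sub_add_cancel hprime.one_le]
    calc _ = M * (B ^ p / (p - 1).factorial) := by
          rw [hB, mul_pow, ← pow_mul, mul_comm p]; ring
      _ = _ := by rw [hpp]; ring
  have hZ0 : Z = 0 := by
    rw [Complex.norm_intCast] at hZlt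
    exact Int.abs_lt_one_iff.1 (by exact_mod_cast hZlt)
  have hdvd : (p : ℤ) ∣ a ^ (p * f.natDegree) * (n * c 0) :=
    (dvd_add_left (dvd_mul_right _ _)).1 (hZ ▸ hZ0 ▸ dvd_zero _)
  rcases hpZ.dvd_or_dvd hdvd with h | h
  · exact not_dvd a ha (by omega) (hpZ.dvd_of_dvd_pow h)
  · exact (hpZ.dvd_or_dvd h).elim hpn (not_dvd _ hc (by omega))

theorem AddMonoidAlgebra.aeval_single_ne_zero {K : Type*} [Field K] [CharZero K]
    {α : K} (hα : α ≠ 0) {Q : ℤ[X]} (hQ : Q ≠ 0) :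
    aeval (AddMonoidAlgebra.single α (1 : ℤ)) Q ≠ 0 := by
  classical
  contrapose! hQ
  ext k
  have hcoeff := congrArg (fun x ↦ x.coeff (k • α)) hQ
  have : k ≤ Q.natDegree → Q.coeff k = 0 := by
    simpa [aeval_eq_sum_range, AddMonoidAlgebra.single_pow, AddMonoidAlgebra.coeff_sum,
      Finsupp.single_apply, hα, -zsmul_eq_mul, AddMonoidAlgebra.smul_single] using hcoeff
  by_contra hk
  exact hk (this (le_natDegree_of_ne_zero hk))

theorem LindemannWeierstrass.aeval_exp_ne_zero {K : Type*} [Field K]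
    [NumberField K] [IsGalois ℚ K] [Algebra K ℂ] {α : K} (hα : α ≠ 0) {Q : ℤ[X]} (hQ : Q ≠ 0) :
    aeval (Complex.exp (algebraMap K ℂ α)) Q ≠ 0 := by
  classical
  intro hzero
  let E : AddMonoidAlgebra ℤ K →ₐ[ℤ] ℂ := AddMonoidAlgebra.lift ℤ ℂ K
    (Complex.expMonoidHom.comp (AddMonoidHom.toMultiplicative (algebraMap K ℂ).toAddMonoidHom))
  have hE (γ : K) (n : ℤ) :
      E (AddMonoidAlgebra.single γ n) = n • Complex.exp (algebraMap K ℂ γ) := by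
    simp [E, AddMonoidAlgebra.lift_single, Complex.expMonoidHom]
  let act (τ : K ≃ₐ[ℚ] K) : AddMonoidAlgebra ℤ K ≃ₐ[ℤ] AddMonoidAlgebra ℤ K :=
    AddMonoidAlgebra.domCongr ℤ ℤ (τ : K ≃+ K)
  have hact (τ : K ≃ₐ[ℚ] K) (γ : K) (n : ℤ) :
      act τ (AddMonoidAlgebra.single γ n) = AddMonoidAlgebra.single (τ γ) n :=
    AddMonoidAlgebra.domCongr_single ..
  have hcoeff {x : AddMonoidAlgebra ℤ K} (hx : ∀ τ, act τ x = x) (τ : K ≃ₐ[ℚ] K) (γ : K) :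
      x.coeff (τ γ) = x.coeff γ := by
    conv_lhs => rw [← hx τ]
    simp [act]
  let P : AddMonoidAlgebra ℤ K :=
    ∏ σ : K ≃ₐ[ℚ] K, aeval (AddMonoidAlgebra.single (σ α) (1 : ℤ)) Q
  have hP0 : P ≠ 0 := Finset.prod_ne_zero_iff.2 fun σ _ ↦
    AddMonoidAlgebra.aeval_single_ne_zero (by simpa using hα) hQ
  have hPact (τ) : act τ P = P := by
    simp only [P, map_prod, ← aeval_algHom_apply, hact]
    exact Fintype.prod_equiv (Equiv.mulLeft τ) _ _ fun σ ↦ rfl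
  have hEP : E P = 0 := by
    simp only [P, map_prod, ← aeval_algHom_apply, hE]
    exact Finset.prod_eq_zero (Finset.mem_univ 1) (by simpa using hzero)
  obtain ⟨γ, hγ⟩ : ∃ γ, P.coeff γ ≠ 0 := by
    by_contra! h
    exact hP0 (AddMonoidAlgebra.coeff_eq_zero.1 (Finsupp.ext h))
  let R : AddMonoidAlgebra ℤ K := ∑ σ : K ≃ₐ[ℚ] K, AddMonoidAlgebra.single (-(σ γ)) (1 : ℤ)
  have hRact (τ) : act τ R = R := by
    simp only [R, map_sum, hact]
    exact Fintype.sum_equiv (Equiv.mulLeft τ) _ _ fun σ ↦ by simp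
  refine LindemannWeierstrass.sum_exp_ne_zero_of_galois_invariant (P * R).coeff ?_
    (hcoeff fun τ ↦ by rw [map_mul, hPact, hRact]) ?_
  · have (σ : K ≃ₐ[ℚ] K) :
        (P * AddMonoidAlgebra.single (-(σ γ)) (1 : ℤ)).coeff 0 = P.coeff γ := by
      rw [AddMonoidAlgebra.coeff_mul_single_apply]
      simp [hcoeff hPact]
    simp only [R, Finset.mul_sum, AddMonoidAlgebra.coeff_sum, Finsupp.finsetSum_apply, this]
    simpa using hγ
  · have : E (P * R) = 0 := by rw [map_mul, hEP, zero_mul]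
    rw [← this]
    conv_rhs => rw [← AddMonoidAlgebra.sum_coeff_single (P * R)]
    rw [map_finsuppSum]
    simp only [hE, zsmul_eq_mul]

/-- The Hermite-Lindemann theorem. -/
theorem Complex.transcendental_exp {α : ℂ} (hα : IsAlgebraic ℚ α) (h0 : α ≠ 0) :
    Transcendental ℤ (Complex.exp α) := by
  intro hexp
  obtain ⟨Q, hQ, hQexp⟩ := hexp
  have hmin : minpoly ℚ α ≠ 0 := minpoly.ne_zero hα.isIntegral
  let K := IntermediateField.adjoin ℚ ((minpoly ℚ α).rootSet ℂ)
  have hsplit : (minpoly ℚ α).IsSplittingField ℚ K :=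
    IntermediateField.adjoin_rootSet_isSplittingField (IsAlgClosed.splits _)
  have : FiniteDimensional ℚ K := Polynomial.IsSplittingField.finiteDimensional K (minpoly ℚ α)
  have : IsGalois ℚ K :=
    IsGalois.of_separable_splitting_field (minpoly.irreducible hα.isIntegral).separable
  have : NumberField K := ⟨⟩
  have hαK : α ∈ K := IntermediateField.subset_adjoin _ _
    (mem_rootSet.2 ⟨hmin, minpoly.aeval ℚ α⟩)
  refine LindemannWeierstrass.aeval_exp_ne_zero (K := K) (α := ⟨α, hαK⟩) ?_ hQ hQexp
  simpa [Subtype.ext_iff] using h0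

theorem MvPolynomial.isIntegral_of_isRelPrime_of_aeval_eq_zero {A B : Type*} [Field A] [Field B]
    [Algebra A B] {f₁ f₂ : MvPolynomial (Fin 2) A} (h : IsRelPrime f₁ f₂) {v : Fin 2 → B}
    (h₁ : aeval v f₁ = 0) (h₂ : aeval v f₂ = 0) (i : Fin 2) : IsIntegral A (v i) := by
  set P : Ideal (MvPolynomial (Fin 2) A) := RingHom.ker (aeval v : MvPolynomial (Fin 2) A →ₐ[A] B)
    with hP
  have hPprime : P.IsPrime := RingHom.ker_isPrime _
  have hf₁ : f₁ ≠ 0 := by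
    rintro rfl
    have : IsUnit f₂ := isRelPrime_zero_left.1 h
    exact hPprime.ne_top (P.eq_top_of_isUnit_mem h₂ this)
  obtain ⟨g, hg, hgP, hgf₁⟩ : ∃ g, Prime g ∧ g ∈ P ∧ g ∣ f₁ := by
    obtain ⟨s, hs, u, hu⟩ := UniqueFactorizationMonoid.exists_prime_factors f₁ hf₁
    have hsP : s.prod ∈ P :=
      (hPprime.mul_mem_iff_mem_or_mem.1 (hu ▸ h₁ : s.prod * u ∈ P)).resolve_right fun hu' ↦
        hPprime.ne_top (P.eq_top_of_isUnit_mem hu' u.isUnit)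
    obtain ⟨g, hgs, hgP⟩ := hPprime.multiset_prod_mem_iff_exists_mem s |>.1 hsP
    exact ⟨g, hs g hgs, hgP, (Multiset.dvd_prod hgs).trans ⟨u, hu.symm⟩⟩
  have hgf₂ : ¬ g ∣ f₂ := fun hgf₂ ↦ hg.not_isUnit (h hgf₁ hgf₂)
  have hspan : (Ideal.span {g}).IsPrime := (Ideal.span_singleton_prime hg.ne_zero).2 hg
  have hbot_lt : (⊥ : Ideal (MvPolynomial (Fin 2) A)) < Ideal.span {g} :=
    bot_lt_iff_ne_bot.2 (by simpa using hg.ne_zero)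
  have hlt : Ideal.span {g} < P := by
    refine lt_of_le_of_ne ((Ideal.span_singleton_le_iff_mem _).2 hgP) fun heq ↦ hgf₂ ?_
    exact Ideal.mem_span_singleton.1 (heq ▸ h₂)
  have hmax : P.IsMaximal := by
    obtain ⟨M, hM, hPM⟩ := P.exists_le_maximal hPprime.ne_top
    rcases hPM.eq_or_lt with rfl | hPM
    · exact hM
    exfalso
    let q : LTSeries (PrimeSpectrum (MvPolynomial (Fin 2) A)) :=
      ⟨3, ![⟨⊥, Ideal.isPrime_bot⟩, ⟨_, hspan⟩, ⟨P, hPprime⟩, ⟨M, hM.isPrime⟩], fun i ↦ by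
        fin_cases i
        exacts [hbot_lt, hlt, hPM]⟩
    have hq : ((3 : ℕ) : WithBot ℕ∞) ≤ ringKrullDim (MvPolynomial (Fin 2) A) :=
      Order.LTSeries.length_le_krullDim q
    rw [MvPolynomial.ringKrullDim_of_isNoetherianRing, ringKrullDim_eq_zero_of_field] at hq
    norm_num at hq
  let : Field (MvPolynomial (Fin 2) A ⧸ P) := Ideal.Quotient.field P
  have hint : IsIntegral A (Ideal.Quotient.mk P (X i)) :=
    MvPolynomial.comp_C_integral_of_surjective_of_isJacobsonRing (Ideal.Quotient.mk P)
      Ideal.Quotient.mk_surjective _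
  have := hint.map (Ideal.kerLiftAlg (aeval v : MvPolynomial (Fin 2) A →ₐ[A] B))
  rw [Ideal.kerLiftAlg_mk] at this
  simpa using this

theorem stmt_1 (f₁ f₂ : MvPolynomial (Fin 2) AlgNum)
    (hcoprime : IsRelPrime f₁ f₂) :
    ∀ x : ℂ, x ≠ 0 → ¬(evalExp f₁ x = 0 ∧ evalExp f₂ x = 0) := by
  rintro x hx ⟨h₁, h₂⟩
  have eval_eq (f : MvPolynomial (Fin 2) AlgNum) :
      evalExp f x = MvPolynomial.aeval ![x, Complex.exp (Complex.I * x)] f := by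
    rw [evalExp, MvPolynomial.eval_map, MvPolynomial.aeval_def]
  rw [eval_eq] at h₁ h₂
  have hint (i : Fin 2) : IsIntegral AlgNum (![x, Complex.exp (Complex.I * x)] i) :=
    MvPolynomial.isIntegral_of_isRelPrime_of_aeval_eq_zero (A := algebraicClosure ℚ ℂ)
      hcoprime h₁ h₂ i
  have hx_alg : IsIntegral ℚ x := isIntegral_trans x (hint 0)
  have hexp_alg : IsIntegral ℚ (Complex.exp (Complex.I * x)) := isIntegral_trans _ (hint 1)
  have hI : IsIntegral ℚ Complex.I := Complex.isIntegral_rat_I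
  exact Complex.transcendental_exp (hI.mul hx_alg).isAlgebraic
    (mul_ne_zero Complex.I_ne_zero hx)
    ((IsFractionRing.isAlgebraic_iff ℤ ℚ ℂ).2 hexp_alg.isAlgebraic)
end
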